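/- Let G = PSL(2,ℤ) with r, u, S = {r, u, u⁻¹} as above, and let a ∈ {u, u⁻¹} with ā = a⁻¹. If g ∈ G satisfies 𝐒₂*(g) = {ar}, then S⁺(g) = {u, u⁻¹}, 𝐒₂*(g·a) = {ra, ār}, and 𝐒₂*(g·ā) = {rā}. -/

import Mathlib

namespace PSL2Z

abbrev SL2Z : Type := Matrix.SpecialLinearGroup (Fin 2) ℤ

/-- `PSL(2,ℤ)`: the quotient of `SL(2,ℤ)` by its center `{±I}`. -/
abbrev G : Type := SL2Z ⧸ Subgroup.center SL2Z

/-- The image in `PSL(2,ℤ)` of the matrix `[[0,1],[-1,0]]`. -/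
def r : G := QuotientGroup.mk (⟨!![0, 1; -1, 0], by norm_num [Matrix.det_fin_two_of]⟩ : SL2Z)

/-- The image in `PSL(2,ℤ)` of the matrix `[[1,1],[0,1]]`. -/
def u : G := QuotientGroup.mk (⟨!![1, 1; 0, 1], by norm_num [Matrix.det_fin_two_of]⟩ : SL2Z)

/-- The symmetric generating set `S = {r, u, u⁻¹}`. -/
def S : Set G := {r, u, u⁻¹}

/-- A word in `S`: a finite list of elements of `S`. -/
def IsWord (w : List G) : Prop := ∀ x ∈ w, x ∈ S

/-- The word norm `|g|`: the least length of a word in `S` representing `g`. -/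
noncomputable def wordNorm (g : G) : ℕ :=
  sInf {n | ∃ w : List G, IsWord w ∧ w.prod = g ∧ w.length = n}

/-- A geodesic for `g`: a word in `S` representing `g` of length `|g|`. -/
def IsGeodesic (g : G) (w : List G) : Prop :=
  IsWord w ∧ w.prod = g ∧ w.length = wordNorm g

/-- `𝐒ₙ(g)`: the set of suffixes of length `n` of geodesics for `g`. -/
def Suf (n : ℕ) (g : G) : Set (List G) :=
  {v | v.length = n ∧ ∃ w : List G, IsGeodesic g w ∧ v <:+ w}

open Classical in
/-- `𝐒₂*(g)`: `𝐒₂(g)` if nonempty, otherwise `𝐒₁(g)` (which is `∅` exactly when `g = 1`). -/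
noncomputable def Suf2Star (g : G) : Set (List G) :=
  if (Suf 2 g).Nonempty then Suf 2 g else Suf 1 g

/-- `S⁺(g) = {s ∈ S : |g·s| = |g| + 1}`. -/
def Splus (g : G) : Set G := {s ∈ S | wordNorm (g * s) = wordNorm g + 1}

/-- The matrix `[[a, b], [c, d]]` as an element of `SL(2,ℤ)`. -/
def sl2 (a b c d : ℤ) (h : a * d - b * c = 1) : SL2Z :=
  ⟨!![a, b; c, d], by rw [Matrix.det_fin_two_of, h]⟩

lemma sl2_mul {a b c d a' b' c' d' : ℤ} (h : a * d - b * c = 1) (h' : a' * d' - b' * c' = 1) :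
    sl2 a b c d h * sl2 a' b' c' d' h' =
      sl2 (a * a' + b * c') (a * b' + b * d') (c * a' + d * c') (c * b' + d * d')
        (by linear_combination (a' * d' - b' * c') * h + h') :=
  Subtype.ext (Matrix.mul_fin_two a b c d a' b' c' d')

lemma sl2_inv {a b c d : ℤ} (h : a * d - b * c = 1) :
    (sl2 a b c d h)⁻¹ = sl2 d (-b) (-c) a (by linear_combination h) :=
  Subtype.ext (Matrix.adjugate_fin_two_of a b c d)

lemma r_eq : r = QuotientGroup.mk (sl2 0 1 (-1) 0 (by norm_num)) := rfl

lemma u_eq : u = QuotientGroup.mk (sl2 1 1 0 1 (by norm_num)) := rfl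

lemma one_eq : (1 : G) = QuotientGroup.mk (sl2 1 0 0 1 (by norm_num)) := by
  rw [← QuotientGroup.mk_one]
  exact congrArg _ (Subtype.ext Matrix.one_fin_two)

lemma mk_sl2_eq_iff {a b c d a' b' c' d' : ℤ} (h : a * d - b * c = 1)
    (h' : a' * d' - b' * c' = 1) :
    (QuotientGroup.mk (sl2 a b c d h) : G) = QuotientGroup.mk (sl2 a' b' c' d' h') ↔
      (a = a' ∧ b = b' ∧ c = c' ∧ d = d') ∨ (a = -a' ∧ b = -b' ∧ c = -c' ∧ d = -d') := by
  rw [QuotientGroup.eq, Matrix.SpecialLinearGroup.mem_center_iff, sl2_inv, sl2_mul]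
  constructor
  · rintro ⟨z, hz, hA⟩
    have h1 : Matrix.diagonal (fun _ => z) 0 0 = _ := congrFun₂ hA 0 0
    have h2 : Matrix.diagonal (fun _ => z) 0 1 = _ := congrFun₂ hA 0 1
    have h3 : Matrix.diagonal (fun _ => z) 1 0 = _ := congrFun₂ hA 1 0
    have h4 : Matrix.diagonal (fun _ => z) 1 1 = _ := congrFun₂ hA 1 1
    simp [sl2] at h1 h2 h3 h4 hz
    have ea : a' = a * z := by linear_combination (-a') * h - a * h1 - b * h3
    have eb : b' = b * z := by linear_combination (-b') * h - a * h2 - b * h4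
    have ec : c' = c * z := by linear_combination (-c') * h - c * h1 - d * h3
    have ed : d' = d * z := by linear_combination (-d') * h - c * h2 - d * h4
    have hz' : z = 1 ∨ z = -1 := hz
    rcases hz' with rfl | rfl
    · left; refine ⟨?_, ?_, ?_, ?_⟩ <;> linarith
    · right; refine ⟨?_, ?_, ?_, ?_⟩ <;> linarith
  · rintro (⟨rfl, rfl, rfl, rfl⟩ | ⟨rfl, rfl, rfl, rfl⟩)
    · refine ⟨1, by simp, ?_⟩
      ext i j; fin_cases i <;> fin_cases j <;> simp [sl2] <;> linarith
    · refine ⟨-1, by simp, ?_⟩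
      ext i j; fin_cases i <;> fin_cases j <;> simp [sl2] <;> linarith

lemma r_mul_r : r * r = 1 := by
  rw [r_eq, ← QuotientGroup.mk_mul, sl2_mul, one_eq, mk_sl2_eq_iff]
  norm_num

lemma mul_r_mul_r (x : G) : x * r * r = x := by rw [mul_assoc, r_mul_r, mul_one]

lemma r_inv : r⁻¹ = r := inv_eq_of_mul_eq_one_right r_mul_r

/-- The braid-type relation, equivalent to `(ar)³ = 1`. -/
lemma letter_mul_r_mul_letter {a : G} (ha : a ∈ ({u, u⁻¹} : Set G)) :
    a * r * a = r * a⁻¹ * r := by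
  have h : u * r * u = r * u⁻¹ * r := by
    rw [u_eq, r_eq, ← QuotientGroup.mk_inv, sl2_inv]
    simp only [← QuotientGroup.mk_mul, sl2_mul, mk_sl2_eq_iff]
    norm_num
  rcases ha with rfl | rfl
  · exact h
  · have h' := congrArg (fun x : G => x⁻¹) h
    simpa [mul_inv_rev, r_inv, mul_assoc] using h'

lemma inv_mem_letters {a : G} (ha : a ∈ ({u, u⁻¹} : Set G)) : a⁻¹ ∈ ({u, u⁻¹} : Set G) := by
  rcases ha with rfl | rfl <;> simp

lemma letters_eq {a : G} (ha : a ∈ ({u, u⁻¹} : Set G)) : ({u, u⁻¹} : Set G) = {a, a⁻¹} := by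
  rcases ha with rfl | rfl
  · rfl
  · rw [inv_inv, Set.pair_comm]

lemma mem_S_iff {a : G} (ha : a ∈ ({u, u⁻¹} : Set G)) (s : G) :
    s ∈ S ↔ s = r ∨ s = a ∨ s = a⁻¹ := by
  have h : s ∈ S ↔ s = r ∨ s ∈ ({u, u⁻¹} : Set G) := Iff.rfl
  rw [h, letters_eq ha]; rfl

lemma inv_mem_S {s : G} (hs : s ∈ S) : s⁻¹ ∈ S := by
  rcases hs with rfl | rfl | rfl <;> simp [S, r_inv]

/-! ### Normal forms -/

/-- `Near x a n`: `x` is a reduced word of length `n` not ending in `r`, and `a` is its last letter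
(arbitrary if `x` is empty). The reduced words are those in which successive maximal blocks of
letters `u^{±1}` are separated by a single `r` and have alternating signs. -/
inductive Near : G → G → ℕ → Prop
  | one {a : G} (ha : a ∈ ({u, u⁻¹} : Set G)) : Near 1 a 0
  | same {x a : G} {n : ℕ} (h : Near x a n) : Near (x * a) a (n + 1)
  | flip {x a : G} {n : ℕ} (h : Near x a n) : Near (x * r * a⁻¹) a⁻¹ (n + 2)

lemma Near.mem_letters {x a : G} {n : ℕ} (h : Near x a n) : a ∈ ({u, u⁻¹} : Set G) := by
  induction h with
  | one ha => exact ha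
  | same _ ih => exact ih
  | flip _ ih => exact inv_mem_letters ih

/-- `g` has a normal form of length `n`. -/
def HasForm (g : G) (n : ℕ) : Prop :=
  (∃ a, Near g a n) ∨ ∃ x a m, Near x a m ∧ g = x * r ∧ n = m + 1

lemma Near.hasForm {x a : G} {n : ℕ} (h : Near x a n) : HasForm x n := Or.inl ⟨a, h⟩

lemma Near.hasForm_mul_r {x a : G} {n : ℕ} (h : Near x a n) : HasForm (x * r) (n + 1) :=
  Or.inr ⟨x, a, n, h, rfl, rfl⟩

lemma HasForm.mul_mem_S {g s : G} {n : ℕ} (h : HasForm g n) (hs : s ∈ S) :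
    ∃ k ≤ n + 1, HasForm (g * s) k := by
  rcases h with ⟨a, h⟩ | ⟨x, a, m, h, rfl, rfl⟩
  · rcases (mem_S_iff h.mem_letters s).mp hs with rfl | rfl | rfl
    · exact ⟨n + 1, le_rfl, h.hasForm_mul_r⟩
    · exact ⟨n + 1, le_rfl, h.same.hasForm⟩
    · cases h with
      | one ha => exact ⟨1, by lia, (Near.one (inv_mem_letters ha)).same.hasForm⟩
      | @same _ _ m h => exact ⟨m, by lia, by simpa using h.hasForm⟩
      | @flip _ _ m h => exact ⟨m + 1, by lia, by simpa using h.hasForm_mul_r⟩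
  · rcases (mem_S_iff h.mem_letters s).mp hs with rfl | rfl | rfl
    · exact ⟨m, by lia, by simpa [mul_r_mul_r] using h.hasForm⟩
    · cases h with
      | one ha => exact ⟨2, by lia, by simpa using (Near.one (inv_mem_letters ha)).flip.hasForm⟩
      | @same x _ m h =>
        refine ⟨m + 3, by lia, ?_⟩
        have e : x * s * r * s = x * r * s⁻¹ * r := by
          simpa [mul_assoc] using congrArg (x * ·) (letter_mul_r_mul_letter h.mem_letters)
        rw [e]
        exact h.flip.hasForm_mul_r
      | @flip x a m h =>
        refine ⟨m + 2, by lia, ?_⟩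
        have e : x * r * a⁻¹ * r * a⁻¹ = x * a * r := by
          have := congrArg (x * r * ·) (letter_mul_r_mul_letter (inv_mem_letters h.mem_letters))
          simp only [← mul_assoc, inv_inv, mul_r_mul_r] at this
          exact this
        rw [e]
        exact h.same.hasForm_mul_r
    · exact ⟨m + 2, by lia, h.flip.hasForm⟩

lemma exists_hasForm_prod (w : List G) (hw : IsWord w) : ∃ k ≤ w.length, HasForm w.prod k := by
  induction w using List.reverseRecOn with
  | nil => exact ⟨0, le_rfl, by simpa using (Near.one (a := u) (by simp)).hasForm⟩
  | append_singleton w s ih =>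
    obtain ⟨k, hk, h⟩ := ih fun x hx => hw x (by simp [hx])
    obtain ⟨k', hk', h'⟩ := h.mul_mem_S (hw s (by simp))
    exact ⟨k', by simp; lia, by simpa using h'⟩

/-! ### Uniqueness of the length of a normal form -/

/-- `PosMat a b c d j n`: the matrix `[[a,b],[c,d]]` is a product of copies of `[[1,1],[0,1]]` and
`[[1,0],[1,1]]`. The flag `j` records whether the last factor is the first of these (or the product
is empty), and `n` is the length of the reduced word attached to the product. -/
inductive PosMat : ℤ → ℤ → ℤ → ℤ → Bool → ℕ → Prop
  | one : PosMat 1 0 0 1 true 0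
  | upper {a b c d : ℤ} {j : Bool} {n : ℕ} (h : PosMat a b c d j n) :
      PosMat a (a + b) c (c + d) true (n + if j then 1 else 2)
  | lower {a b c d : ℤ} {j : Bool} {n : ℕ} (h : PosMat a b c d j n) :
      PosMat (a + b) b (c + d) d false (n + if j then 2 else 1)

lemma PosMat.nonneg {a b c d : ℤ} {j : Bool} {n : ℕ} (h : PosMat a b c d j n) :
    0 ≤ a ∧ 0 ≤ b ∧ 0 ≤ c ∧ 0 ≤ d ∧ a * d - b * c = 1 := by
  induction h with
  | one => simp
  | upper _ ih => obtain ⟨h1, h2, h3, h4, h5⟩ := ih; refine ⟨?_, ?_, ?_, ?_, ?_⟩ <;> linarith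
  | lower _ ih => obtain ⟨h1, h2, h3, h4, h5⟩ := ih; refine ⟨?_, ?_, ?_, ?_, ?_⟩ <;> linarith

lemma PosMat.eq_one_or_upper_or_lower {a b c d : ℤ} {j : Bool} {n : ℕ} (h : PosMat a b c d j n) :
    (a = 1 ∧ b = 0 ∧ c = 0 ∧ d = 1 ∧ j = true ∧ n = 0) ∨
    (∃ i m, PosMat a (b - a) c (d - c) i m ∧ j = true ∧ n = m + if i then 1 else 2) ∨
    (∃ i m, PosMat (a - b) b (c - d) d i m ∧ j = false ∧ n = m + if i then 2 else 1) := by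
  cases h with
  | one => simp
  | upper h => exact Or.inr (Or.inl ⟨_, _, by simpa using h, rfl, rfl⟩)
  | lower h => exact Or.inr (Or.inr ⟨_, _, by simpa using h, rfl, rfl⟩)

lemma PosMat.unique {a b c d : ℤ} {j j' : Bool} {n n' : ℕ} (h : PosMat a b c d j n)
    (h' : PosMat a b c d j' n') : j = j' ∧ n = n' := by
  induction h generalizing j' n' with
  | one =>
    rcases h'.eq_one_or_upper_or_lower with ⟨-, -, -, -, rfl, rfl⟩ | ⟨i, m, h, -, -⟩ | ⟨i, m, h, -, -⟩
    · simp
    · have := h.nonneg; lia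
    · have := h.nonneg; lia
  | @upper a b c d _ _ h ih =>
    have hp := h.nonneg
    rcases h'.eq_one_or_upper_or_lower with ⟨h1, h2, -⟩ | ⟨i, m, h, rfl, rfl⟩ | ⟨i, m, h, -, -⟩
    · lia
    · obtain ⟨rfl, rfl⟩ := ih (by simpa using h)
      simp
    · have hq := h.nonneg
      have hb : b = 0 := by lia
      have hd : d = 0 := by lia
      simp [hb, hd] at hp
  | @lower a b c d _ _ h ih =>
    have hp := h.nonneg
    rcases h'.eq_one_or_upper_or_lower with ⟨-, -, h1, h2, -⟩ | ⟨i, m, h, -, -⟩ | ⟨i, m, h, rfl, rfl⟩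
    · lia
    · have hq := h.nonneg
      have ha : a = 0 := by lia
      have hc : c = 0 := by lia
      simp [ha, hc] at hp
    · obtain ⟨rfl, rfl⟩ := ih (by simpa using h)
      simp

/-- `[[a, eb], [ec, d]]` for a sign `e`. -/
def signedMat (e : ℤˣ) (a b c d : ℤ) (h : a * d - b * c = 1) : SL2Z :=
  sl2 a (e * b) (e * c) d (by rcases Int.units_eq_one_or e with rfl | rfl <;> simpa using h)

lemma mk_signedMat_mul_zpow (e : ℤˣ) {a b c d : ℤ} (h : a * d - b * c = 1)
    (h' : a * (c + d) - (a + b) * c = 1) :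
    (QuotientGroup.mk (signedMat e a b c d h) : G) * u ^ (e : ℤ) =
      QuotientGroup.mk (signedMat e a (a + b) c (c + d) h') := by
  rcases Int.units_eq_one_or e with rfl | rfl
  · rw [Units.val_one, zpow_one, u_eq]
    simp only [signedMat, ← QuotientGroup.mk_mul, sl2_mul, mk_sl2_eq_iff]
    left; simp
  · rw [Units.val_neg, Units.val_one, zpow_neg_one, u_eq, ← QuotientGroup.mk_inv, sl2_inv]
    simp only [signedMat, ← QuotientGroup.mk_mul, sl2_mul, mk_sl2_eq_iff]
    left; simp; ring

lemma mk_signedMat_mul_r_mul_zpow (e : ℤˣ) {a b c d : ℤ} (h : a * d - b * c = 1)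
    (h' : (a + b) * d - b * (c + d) = 1) :
    (QuotientGroup.mk (signedMat e a b c d h) : G) * r * u ^ (-e : ℤ) =
      QuotientGroup.mk (signedMat e (a + b) b (c + d) d h') * r := by
  rcases Int.units_eq_one_or e with rfl | rfl
  · rw [Units.val_one, zpow_neg_one, u_eq, r_eq, ← QuotientGroup.mk_inv, sl2_inv]
    simp only [signedMat, ← QuotientGroup.mk_mul, sl2_mul, mk_sl2_eq_iff]
    left; refine ⟨?_, ?_, ?_, ?_⟩ <;> simp <;> ring
  · rw [Units.val_neg, Units.val_one, neg_neg, zpow_one, u_eq, r_eq]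
    simp only [signedMat, ← QuotientGroup.mk_mul, sl2_mul, mk_sl2_eq_iff]
    left; simp; ring

lemma Near.exists_posMat {x t : G} {n : ℕ} (hx : Near x t n) :
    ∃ (e : ℤˣ) (a b c d : ℤ) (h : a * d - b * c = 1) (j : Bool), PosMat a b c d j n ∧
      x = QuotientGroup.mk (signedMat e a b c d h) * (if j then 1 else r) ∧
      t = u ^ (if j then e else -e : ℤ) := by
  induction hx with
  | @one t ht =>
    have h1 (e : ℤˣ) : (QuotientGroup.mk (signedMat e 1 0 0 1 (by norm_num)) : G) = 1 := by
      rw [one_eq, signedMat, mk_sl2_eq_iff]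
      simp
    rcases ht with rfl | rfl
    · exact ⟨1, 1, 0, 0, 1, by norm_num, true, .one, by simp [h1], by simp⟩
    · exact ⟨-1, 1, 0, 0, 1, by norm_num, true, .one, by simp [h1], by simp⟩
  | same _ ih =>
    obtain ⟨e, a, b, c, d, h, j, hp, rfl, rfl⟩ := ih
    cases j
    · refine ⟨e, _, _, _, _, hp.lower.nonneg.2.2.2.2, false, hp.lower, ?_, by simp⟩
      simpa using mk_signedMat_mul_r_mul_zpow e h _
    · refine ⟨e, _, _, _, _, hp.upper.nonneg.2.2.2.2, true, hp.upper, ?_, by simp⟩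
      simpa using mk_signedMat_mul_zpow e h _
  | flip _ ih =>
    obtain ⟨e, a, b, c, d, h, j, hp, rfl, rfl⟩ := ih
    cases j
    · refine ⟨e, _, _, _, _, hp.upper.nonneg.2.2.2.2, true, hp.upper, ?_, by simp⟩
      simpa [mul_r_mul_r] using mk_signedMat_mul_zpow e h _
    · refine ⟨e, _, _, _, _, hp.lower.nonneg.2.2.2.2, false, hp.lower, ?_, by simp⟩
      simpa using mk_signedMat_mul_r_mul_zpow e h _

lemma HasForm.exists_posMat {g : G} {n : ℕ} (hg : HasForm g n) :
    ∃ (e : ℤˣ) (a b c d : ℤ) (h : a * d - b * c = 1) (j k : Bool) (m : ℕ), PosMat a b c d j m ∧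
      g = QuotientGroup.mk (signedMat e a b c d h) * (if k then r else 1) ∧
      n = m + if k = j then 1 else 0 := by
  rcases hg with ⟨t, hx⟩ | ⟨x, t, m, hx, rfl, rfl⟩
  · obtain ⟨e, a, b, c, d, h, j, hp, rfl, -⟩ := hx.exists_posMat
    exact ⟨e, a, b, c, d, h, j, !j, n, hp, by cases j <;> simp, by simp⟩
  · obtain ⟨e, a, b, c, d, h, j, hp, rfl, -⟩ := hx.exists_posMat
    exact ⟨e, a, b, c, d, h, j, j, m, hp, by cases j <;> simp [mul_r_mul_r], by simp⟩

lemma mk_signedMat_injective {e e' : ℤˣ} {a b c d a' b' c' d' : ℤ} {h : a * d - b * c = 1}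
    {h' : a' * d' - b' * c' = 1} (ha : 0 ≤ a) (hb : 0 ≤ b) (hc : 0 ≤ c) (hd : 0 ≤ d)
    (ha' : 0 ≤ a') (hb' : 0 ≤ b') (hc' : 0 ≤ c') (hd' : 0 ≤ d')
    (he : (QuotientGroup.mk (signedMat e a b c d h) : G) =
      QuotientGroup.mk (signedMat e' a' b' c' d' h')) :
    a = a' ∧ b = b' ∧ c = c' ∧ d = d' := by
  simp only [signedMat, mk_sl2_eq_iff] at he
  have ha0 : a ≠ 0 ∨ b ≠ 0 := by by_contra! H; simp [H] at h
  rcases Int.units_eq_one_or e with rfl | rfl <;>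
    rcases Int.units_eq_one_or e' with rfl | rfl <;> simp at he <;> lia

lemma mk_signedMat_mul_r_ne {e e' : ℤˣ} {a b c d a' b' c' d' : ℤ} {h : a * d - b * c = 1}
    {h' : a' * d' - b' * c' = 1} (ha : 0 ≤ a) (hb : 0 ≤ b) (hc : 0 ≤ c) (hd : 0 ≤ d)
    (ha' : 0 ≤ a') (hb' : 0 ≤ b') (hc' : 0 ≤ c') (hd' : 0 ≤ d') :
    (QuotientGroup.mk (signedMat e a b c d h) : G) * r ≠
      QuotientGroup.mk (signedMat e' a' b' c' d' h') := by
  intro he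
  rw [r_eq, signedMat, signedMat, ← QuotientGroup.mk_mul, sl2_mul, mk_sl2_eq_iff] at he
  have ha0 : a ≠ 0 ∨ b ≠ 0 := by by_contra! H; simp [H] at h
  have hb0 : b ≠ 0 ∨ d ≠ 0 := by by_contra! H; simp [H] at h
  have hc0 : a ≠ 0 ∨ c ≠ 0 := by by_contra! H; simp [H] at h
  rcases Int.units_eq_one_or e with rfl | rfl <;>
    rcases Int.units_eq_one_or e' with rfl | rfl <;> simp at he <;> lia

lemma HasForm.unique {g : G} {n n' : ℕ} (h : HasForm g n) (h' : HasForm g n') : n = n' := by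
  obtain ⟨e, a, b, c, d, hdet, j, k, m, hp, rfl, rfl⟩ := h.exists_posMat
  obtain ⟨e', a', b', c', d', hdet', j', k', m', hp', he, rfl⟩ := h'.exists_posMat
  obtain ⟨ha, hb, hc, hd, -⟩ := hp.nonneg
  obtain ⟨ha', hb', hc', hd', -⟩ := hp'.nonneg
  have hk : k = k' := by
    cases k <;> cases k' <;> simp only [if_true, if_false, Bool.false_eq_true, mul_one] at he
    · rfl
    · exact absurd he.symm (mk_signedMat_mul_r_ne ha' hb' hc' hd' ha hb hc hd)
    · exact absurd he (mk_signedMat_mul_r_ne ha hb hc hd ha' hb' hc' hd')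
    · rfl
  subst hk
  obtain ⟨rfl, rfl, rfl, rfl⟩ := mk_signedMat_injective ha hb hc hd ha' hb' hc' hd'
    (mul_right_cancel he)
  obtain ⟨rfl, rfl⟩ := hp.unique hp'
  rfl

/-! ### Word norm and suffixes of geodesics -/

lemma Near.exists_word {x a : G} {n : ℕ} (h : Near x a n) :
    ∃ w : List G, IsWord w ∧ w.prod = x ∧ w.length = n := by
  induction h with
  | one => exact ⟨[], by simp [IsWord], rfl, rfl⟩
  | @same x a n h ih =>
    obtain ⟨w, hw, rfl, rfl⟩ := ih
    refine ⟨w ++ [a], ?_, by simp, by simp⟩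
    have := (mem_S_iff h.mem_letters a).mpr (by simp)
    grind [IsWord]
  | @flip x a n h ih =>
    obtain ⟨w, hw, rfl, rfl⟩ := ih
    refine ⟨w ++ [r, a⁻¹], ?_, by simp [mul_assoc], by simp⟩
    have := (mem_S_iff h.mem_letters a⁻¹).mpr (by simp)
    have := (mem_S_iff h.mem_letters r).mpr (by simp)
    grind [IsWord]

lemma HasForm.exists_word {g : G} {n : ℕ} (h : HasForm g n) :
    ∃ w : List G, IsWord w ∧ w.prod = g ∧ w.length = n := by
  rcases h with ⟨a, h⟩ | ⟨x, a, m, h, rfl, rfl⟩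
  · exact h.exists_word
  · obtain ⟨w, hw, rfl, rfl⟩ := h.exists_word
    refine ⟨w ++ [r], ?_, by simp, by simp⟩
    have := (mem_S_iff h.mem_letters r).mpr (by simp)
    grind [IsWord]

lemma HasForm.wordNorm_eq {g : G} {n : ℕ} (h : HasForm g n) : wordNorm g = n := by
  apply IsLeast.csInf_eq
  refine ⟨h.exists_word, ?_⟩
  rintro _ ⟨w, hw, rfl, rfl⟩
  obtain ⟨k, hk, h'⟩ := exists_hasForm_prod w hw
  exact (h.unique h').le.trans hk

lemma IsWord.append {v w : List G} (hv : IsWord v) (hw : IsWord w) : IsWord (v ++ w) := by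
  intro x hx
  rcases List.mem_append.mp hx with h | h
  exacts [hv x h, hw x h]

lemma pair_mem_Suf_iff {g : G} {n : ℕ} (hg : HasForm g (n + 2)) (s t : G) :
    [s, t] ∈ Suf 2 g ↔
      s ∈ S ∧ t ∈ S ∧ HasForm (g * t⁻¹) (n + 1) ∧ HasForm (g * t⁻¹ * s⁻¹) n := by
  constructor
  · rintro ⟨-, _, ⟨hw, hp, hl⟩, v, rfl⟩
    rw [hg.wordNorm_eq] at hl
    have hs : s ∈ S := hw s (by simp)
    have ht : t ∈ S := hw t (by simp)
    have hv : v.prod = g * t⁻¹ * s⁻¹ := by simp [← hp, mul_assoc]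
    obtain ⟨k, hk, h⟩ := exists_hasForm_prod v fun x hx => hw x (by simp [hx])
    obtain ⟨l, hl', h'⟩ := h.mul_mem_S hs
    obtain ⟨m, hm, h''⟩ := h'.mul_mem_S ht
    have hg' : v.prod * s * t = g := by simp [hv]
    have := hg.unique (hg' ▸ h'')
    simp at hl
    obtain rfl : k = n := by lia
    obtain rfl : l = k + 1 := by lia
    exact ⟨hs, ht, by simpa [hv] using h', hv ▸ h⟩
  · rintro ⟨hs, ht, -, h⟩
    obtain ⟨w, hw, hp, rfl⟩ := h.exists_word
    refine ⟨rfl, w ++ [s, t], ⟨hw.append (by simp [IsWord, hs, ht]), by simp [hp], ?_⟩, ⟨w, rfl⟩⟩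
    rw [hg.wordNorm_eq]; simp

lemma Suf2Star_eq_Suf_two {g : G} {s t : G} (h : [s, t] ∈ Suf2Star g) :
    Suf2Star g = Suf 2 g := by
  rw [Suf2Star] at h ⊢
  split_ifs at h ⊢ with h2
  · rfl
  · exact absurd h.1 (by simp)

/-- To determine `𝐒₂*(g)` it is enough to test pairs of letters. -/
lemma Suf2Star_eq {g : G} {n : ℕ} (hg : HasForm g (n + 2)) {A : Set (List G)} (hA : A.Nonempty)
    (hlen : ∀ v ∈ A, v.length = 2)
    (h : ∀ s t, [s, t] ∈ A ↔
      s ∈ S ∧ t ∈ S ∧ HasForm (g * t⁻¹) (n + 1) ∧ HasForm (g * t⁻¹ * s⁻¹) n) :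
    Suf2Star g = A := by
  have key : Suf 2 g = A := by
    ext v
    by_cases hv : v.length = 2
    · obtain ⟨s, t, rfl⟩ := List.length_eq_two.mp hv
      rw [pair_mem_Suf_iff hg, h]
    · exact ⟨fun h' => absurd h'.1 hv, fun h' => absurd (hlen v h') hv⟩
  rw [← key] at hA ⊢
  exact if_pos hA

/-- If `ar` is the only suffix of length two of geodesics for `g`, then the normal form of `g` is
`x'ar` where `x'` is empty or ends with `a`. -/
lemma exists_near_of_Suf2Star {a : G} (ha : a ∈ ({u, u⁻¹} : Set G)) {g : G}
    (hg : Suf2Star g = ({[a, r]} : Set (List G))) :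
    ∃ x m, Near x a m ∧ g = x * a * r := by
  have hS : Suf 2 g = {[a, r]} := by
    rw [← hg, Suf2Star_eq_Suf_two (s := a) (t := r) (by simp [hg])]
  have hmem : [a, r] ∈ Suf 2 g := by simp [hS]
  obtain ⟨n, hn⟩ : ∃ n, HasForm g (n + 2) := by
    obtain ⟨-, w, hw, v, rfl⟩ := hmem
    obtain ⟨k, hk, h⟩ := exists_hasForm_prod _ hw.1
    rw [hw.2.1] at h
    have h2 := hw.2.2
    rw [h.wordNorm_eq] at h2
    simp at h2
    exact ⟨v.length, h2 ▸ h⟩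
  obtain ⟨-, -, h1, h2⟩ := (pair_mem_Suf_iff hn a r).mp hmem
  rw [r_inv] at h1 h2
  rcases hn with ⟨b, h⟩ | ⟨x, b, m, h, rfl, hm⟩
  · have := h1.unique h.hasForm_mul_r
    lia
  rw [mul_r_mul_r] at h1 h2
  cases h with
  | one hb => simp at hm
  | @same x _ k h =>
    obtain rfl : k = n := by lia
    have hb : b = a ∨ b = a⁻¹ := by
      have := h.mem_letters
      rwa [letters_eq ha] at this
    rcases hb with rfl | rfl
    · exact ⟨x, _, h, rfl⟩
    · have := h2.unique h.same.same.hasForm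
      lia
  | @flip x c k h =>
    obtain rfl : k + 1 = n := by lia
    have e : x * r * c⁻¹ * r = x * c * r * c := by
      simpa [mul_assoc] using congrArg (x * ·) (letter_mul_r_mul_letter h.mem_letters).symm
    have hc : [r, c] ∈ Suf 2 (x * r * c⁻¹ * r) := by
      rw [pair_mem_Suf_iff h.flip.hasForm_mul_r, e, mul_inv_cancel_right, r_inv, mul_r_mul_r,
        mem_S_iff h.mem_letters, mem_S_iff h.mem_letters]
      exact ⟨by simp, by simp, h.same.hasForm_mul_r, h.same.hasForm⟩
    rw [hS] at hc
    obtain ⟨rfl, -⟩ : r = a ∧ c = r := by simpa using hc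
    have h3 := (Near.one ha).same.hasForm_mul_r
    rw [one_mul, r_mul_r] at h3
    have := h3.unique (Near.one ha).hasForm
    lia

/-- If `𝐒₂*(g) = {ar}` (for `a = u` or `u⁻¹`) then `S⁺(g) = {u, u⁻¹}`,
`𝐒₂*(g·a) = {ra, ār}` and `𝐒₂*(g·ā) = {rā}`. -/
theorem type_ar (a : G) (ha : a ∈ ({u, u⁻¹} : Set G))
    (g : G) (hg : Suf2Star g = ({[a, r]} : Set (List G))) :
    Splus g = {u, u⁻¹} ∧
      Suf2Star (g * a) = {[r, a], [a⁻¹, r]} ∧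
      Suf2Star (g * a⁻¹) = {[r, a⁻¹]} := by
  obtain ⟨x, m, h, rfl⟩ := exists_near_of_Suf2Star ha hg
  have hr : r ∈ S := by simp [S]
  have haS : a ∈ S := (mem_S_iff ha a).mpr (by simp)
  have haS' : a⁻¹ ∈ S := inv_mem_S haS
  have hg := h.same.hasForm_mul_r
  have e : x * a * r * a = x * r * a⁻¹ * r := by
    simpa [mul_assoc] using congrArg (x * ·) (letter_mul_r_mul_letter ha)
  have hga : HasForm (x * a * r * a) (m + 3) := e ▸ h.flip.hasForm_mul_r
  have hgb := h.same.flip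
  refine ⟨?_, ?_, ?_⟩
  · ext s
    rw [letters_eq ha, Splus, Set.mem_ofPred_eq, mem_S_iff ha, hg.wordNorm_eq]
    constructor
    · rintro ⟨rfl | hs, h'⟩
      · rw [mul_r_mul_r, h.same.hasForm.wordNorm_eq] at h'
        lia
      · exact hs
    · rintro (rfl | rfl)
      · exact ⟨by simp, hga.wordNorm_eq⟩
      · exact ⟨by simp, hgb.hasForm.wordNorm_eq⟩
  · refine Suf2Star_eq (n := m + 1) hga (by simp) (by simp) fun s t => ?_
    constructor
    · intro hst
      have hst : s = r ∧ t = a ∨ s = a⁻¹ ∧ t = r := by simpa using hst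
      rcases hst with ⟨rfl, rfl⟩ | ⟨rfl, rfl⟩
      · simpa [r_inv, mul_r_mul_r, hr, haS] using And.intro hg h.same.hasForm
      · rw [e, r_inv, mul_r_mul_r, inv_inv, inv_mul_cancel_right]
        exact ⟨haS', hr, h.flip.hasForm, h.hasForm_mul_r⟩
    · rintro ⟨hs, ht, h1, h2⟩
      rcases (mem_S_iff ha t).mp ht with rfl | rfl | rfl
      · rw [e, r_inv, mul_r_mul_r] at h2
        rcases (mem_S_iff ha s).mp hs with rfl | rfl | rfl
        · rw [r_inv] at h2
          have := h2.unique (h.flip.hasForm_mul_r)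
          lia
        · have := h2.unique h.flip.same.hasForm
          lia
        · simp
      · rw [mul_inv_cancel_right] at h2
        rcases (mem_S_iff ha s).mp hs with rfl | rfl | rfl
        · simp
        · have := h2.unique hgb.hasForm
          lia
        · rw [inv_inv] at h2
          have := h2.unique hga
          lia
      · rw [e] at h1
        have := h1.unique h.flip.flip.hasForm
        lia
  · refine Suf2Star_eq (n := m + 1) hgb.hasForm (by simp) (by simp) fun s t => ?_
    constructor
    · intro hst
      obtain ⟨rfl, rfl⟩ : s = r ∧ t = a⁻¹ := by simpa using hst
      simpa [r_inv, mul_r_mul_r, hr, haS'] using And.intro hg h.same.hasForm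
    · rintro ⟨hs, ht, h1, h2⟩
      rcases (mem_S_iff ha t).mp ht with rfl | rfl | rfl
      · rw [r_inv] at h1
        have := h1.unique (hgb.hasForm_mul_r)
        lia
      · have := h1.unique hgb.same.hasForm
        lia
      · rw [mul_inv_cancel_right] at h2
        rcases (mem_S_iff ha s).mp hs with rfl | rfl | rfl
        · simp
        · have := h2.unique hgb.hasForm
          lia
        · rw [inv_inv] at h2
          have := h2.unique hga
          lia

end PSL2Z
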